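/- Let 1 < p < ∞ and let F ∈ M^p satisfy F(z) ≠ 0 for every z ∈ 𝔻. Then there exists a sequence {F_n}_{n=1}^∞ of functions in M^p such that (F_n)^n = F for every positive integer n, and F_n → 1 in the metric space (M^p, ρ_p) as n → ∞, i.e., ρ_p(F_n, 1) → 0. -/

import Mathlib

open MeasureTheory Filter Set
open scoped ENNReal Topology Real NNReal

noncomputable section

/-- The open unit disk in the complex plane. -/
def unitDisk : Set ℂ := Metric.ball 0 1

/-- The point `r·e^{iθ}`. -/
def circlePt (r θ : ℝ) : ℂ := (r : ℂ) * Complex.exp (θ * Complex.I)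

/-- The maximal radial function `Mf(θ) = sup_{0 ≤ r < 1} |f(r e^{iθ})|`, valued in `ℝ≥0∞`. -/
def maxRad (f : ℂ → ℂ) (θ : ℝ) : ℝ≥0∞ :=
  ⨆ r ∈ Set.Ico (0 : ℝ) 1, (‖f (circlePt r θ)‖₊ : ℝ≥0∞)

/-- `log⁺` on `ℝ≥0∞`. -/
def elogPlus (x : ℝ≥0∞) : ℝ≥0∞ :=
  if x = ∞ then ∞ else ENNReal.ofReal (Real.log x.toReal)

/-- `x ↦ log (1 + x)` on `ℝ≥0∞`. -/
def elog1p (x : ℝ≥0∞) : ℝ≥0∞ :=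
  if x = ∞ then ∞ else ENNReal.ofReal (Real.log (1 + x.toReal))

/-- The radial boundary value `f*(e^{iθ}) = lim_{r→1⁻} f(r e^{iθ})`
(a junk value is returned where the limit does not exist). -/
def radialLimit (f : ℂ → ℂ) (θ : ℝ) : ℂ :=
  limUnder (nhdsWithin (1 : ℝ) (Set.Iio 1)) fun r : ℝ => f (circlePt r θ)

/-- The class `M^p`: holomorphic functions on the unit disk with
`∫₀^{2π} (log⁺ Mf(θ))^p dθ/2π < ∞`. -/
def MpClass (p : ℝ) : Set (ℂ → ℂ) :=
  {f | DifferentiableOn ℂ f unitDisk ∧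
    (∫⁻ θ in Set.Ioc 0 (2 * π), elogPlus (maxRad f θ) ^ p) / ENNReal.ofReal (2 * π) < ∞}

/-- The metric `ρ_p` on `M^p`. -/
def rhoMetric (p : ℝ) (f g : ℂ → ℂ) : ℝ≥0∞ :=
  ((∫⁻ θ in Set.Ioc 0 (2 * π), elog1p (maxRad (f - g) θ) ^ p) /
    ENNReal.ofReal (2 * π)) ^ (1 / p)

/-- The Privalov class `N^p`: holomorphic functions on the unit disk with
`sup_{0≤r<1} ∫₀^{2π} (log⁺|f(re^{iθ})|)^p dθ/2π < ∞`. -/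
def NpClass (p : ℝ) : Set (ℂ → ℂ) :=
  {f | DifferentiableOn ℂ f unitDisk ∧
    (⨆ r ∈ Set.Ico (0 : ℝ) 1,
      (∫⁻ θ in Set.Ioc 0 (2 * π),
        ENNReal.ofReal (Real.log ‖f (circlePt r θ)‖) ^ p) / ENNReal.ofReal (2 * π)) < ∞}

/-- The metric `d_p` on `N^p`, defined via boundary values. -/
def dMetric (p : ℝ) (f g : ℂ → ℂ) : ℝ≥0∞ :=
  ((∫⁻ θ in Set.Ioc 0 (2 * π),
      ENNReal.ofReal (Real.log (1 + ‖radialLimit f θ - radialLimit g θ‖)) ^ p) /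
    ENNReal.ofReal (2 * π)) ^ (1 / p)

/-- The Hardy space `H^p`. -/
def HpClass (p : ℝ) : Set (ℂ → ℂ) :=
  {f | DifferentiableOn ℂ f unitDisk ∧
    (⨆ r ∈ Set.Ico (0 : ℝ) 1,
      (∫⁻ θ in Set.Ioc 0 (2 * π), (‖f (circlePt r θ)‖₊ : ℝ≥0∞) ^ p) /
        ENNReal.ofReal (2 * π)) < ∞}

/-- The Smirnov class `N⁺`. -/
def SmirnovClass : Set (ℂ → ℂ) :=
  {f | DifferentiableOn ℂ f unitDisk ∧
    (∫⁻ θ in Set.Ioc 0 (2 * π), ENNReal.ofReal (Real.log ‖radialLimit f θ‖)) /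
      ENNReal.ofReal (2 * π) < ∞ ∧
    Tendsto
      (fun r : ℝ => (∫⁻ θ in Set.Ioc 0 (2 * π),
        ENNReal.ofReal (Real.log ‖f (circlePt r θ)‖)) / ENNReal.ofReal (2 * π))
      (nhdsWithin (1 : ℝ) (Set.Iio 1))
      (nhds ((∫⁻ θ in Set.Ioc 0 (2 * π),
        ENNReal.ofReal (Real.log ‖radialLimit f θ‖)) / ENNReal.ofReal (2 * π)))}

/-- The normalized Blaschke factor `(|a|/a)·(a − z)/(1 − conj a · z)`. -/
def blaschkeFactor (a z : ℂ) : ℂ :=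
  ((‖a‖ : ℂ) / a) * ((a - z) / (1 - (starRingEnd ℂ) a * z))

/-- `B` is a (finite or infinite) Blaschke product on the unit disk. -/
def IsBlaschkeProduct (B : ℂ → ℂ) : Prop :=
  ∃ m : ℕ,
    (∃ n : ℕ, ∃ a : ℕ → ℂ, (∀ k < n, a k ∈ unitDisk ∧ a k ≠ 0) ∧
      ∀ z ∈ unitDisk, B z = z ^ m * ∏ k ∈ Finset.range n, blaschkeFactor (a k) z) ∨
    (∃ a : ℕ → ℂ, (∀ k, a k ∈ unitDisk ∧ a k ≠ 0) ∧ (Summable fun k => 1 - ‖a k‖) ∧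
      ∀ z ∈ unitDisk, B z = z ^ m * ∏' k, blaschkeFactor (a k) z)

/-- `I` is an ideal of the ring `M^p`. -/
structure IsIdealIn (p : ℝ) (I : Set (ℂ → ℂ)) : Prop where
  subset : I ⊆ MpClass p
  zero_mem : (0 : ℂ → ℂ) ∈ I
  add_mem : ∀ f ∈ I, ∀ g ∈ I, f + g ∈ I
  neg_mem : ∀ f ∈ I, -f ∈ I
  mul_mem : ∀ f ∈ MpClass p, ∀ g ∈ I, f * g ∈ I

/-- `I` is a prime ideal of the ring `M^p`: an ideal such that whenever a product of two
elements of `M^p` lies in `I`, one of the factors lies in `I`. -/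
def IsPrimeIdealIn (p : ℝ) (I : Set (ℂ → ℂ)) : Prop :=
  IsIdealIn p I ∧ ∀ f ∈ MpClass p, ∀ g ∈ MpClass p, f * g ∈ I → f ∈ I ∨ g ∈ I

/-- `I` is a dense subset of the metric space `(M^p, ρ_p)`. -/
def IsDenseIn (p : ℝ) (I : Set (ℂ → ℂ)) : Prop :=
  ∀ f ∈ MpClass p, ∀ ε : ℝ≥0∞, 0 < ε → ∃ g ∈ I, rhoMetric p f g < ε

/-- `I` is an ideal of the ring `N^p`. -/
structure IsIdealInNp (p : ℝ) (I : Set (ℂ → ℂ)) : Prop where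
  subset : I ⊆ NpClass p
  zero_mem : (0 : ℂ → ℂ) ∈ I
  add_mem : ∀ f ∈ I, ∀ g ∈ I, f + g ∈ I
  neg_mem : ∀ f ∈ I, -f ∈ I
  mul_mem : ∀ f ∈ NpClass p, ∀ g ∈ I, f * g ∈ I

/-- `I` is a prime ideal of the ring `N^p`. -/
def IsPrimeIdealInNp (p : ℝ) (I : Set (ℂ → ℂ)) : Prop :=
  IsIdealInNp p I ∧ ∀ f ∈ NpClass p, ∀ g ∈ NpClass p, f * g ∈ I → f ∈ I ∨ g ∈ I

/-- `I` is a dense subset of the metric space `(N^p, d_p)`. -/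
def IsDenseInNp (p : ℝ) (I : Set (ℂ → ℂ)) : Prop :=
  ∀ f ∈ NpClass p, ∀ ε : ℝ≥0∞, 0 < ε → ∃ g ∈ I, dMetric p f g < ε


lemma hl_weak (w : ℝ → ℝ≥0∞) (hw : ∫⁻ t, w t ≠ ∞) (l : ℝ) (hl : 0 < l) (E : Set ℝ)
    (hE : ∀ x ∈ E, ∃ s : ℝ, 0 < s ∧
      ENNReal.ofReal (l * (2 * s)) ≤ ∫⁻ t in Metric.closedBall x s, w t) :
    ENNReal.ofReal l * volume E ≤ 4 * ∫⁻ t, w t := by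
  choose! s hs0 hs using hE
  have hb : ∀ x ∈ E, s x ≤ (∫⁻ t, w t).toReal / (2 * l) := by
    intro x hx
    have h1 : ENNReal.ofReal (l * (2 * s x)) ≤ ∫⁻ t, w t :=
      (hs x hx).trans (setLIntegral_le_lintegral _ _)
    have h2 := (ENNReal.ofReal_le_iff_le_toReal hw).1 h1
    rw [le_div_iff₀ (by positivity)]
    linarith
  obtain ⟨u, huE, hdisj, hcov⟩ :=
    Vitali.exists_disjoint_subfamily_covering_enlargement_closedBall E (fun x => x) s _ hb 4
      (by norm_num)
  have hcount : u.Countable := by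
    refine hdisj.countable_of_nonempty_interior fun a ha => ?_
    refine ⟨a, ?_⟩
    rw [mem_interior_iff_mem_nhds]
    exact Metric.closedBall_mem_nhds _ (hs0 a (huE ha))
  have hsub : E ⊆ ⋃ b ∈ u, Metric.closedBall b (4 * s b) := by
    intro x hx
    obtain ⟨b, hb, hsb⟩ := hcov x hx
    simp only [mem_iUnion]
    exact ⟨b, hb, hsb (Metric.mem_closedBall_self (hs0 x hx).le)⟩
  have := hcount.to_subtype
  calc ENNReal.ofReal l * volume E
      ≤ ENNReal.ofReal l * ∑' b : u, volume (Metric.closedBall (b : ℝ) (4 * s b)) := by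
        gcongr
        exact (measure_mono hsub).trans (measure_biUnion_le _ hcount _)
    _ = ∑' b : u, 4 * ENNReal.ofReal (l * (2 * s b)) := by
        rw [← ENNReal.tsum_mul_left]
        congr 1; ext b
        rw [Real.volume_closedBall, ← ENNReal.ofReal_mul hl.le,
          show (4 : ℝ≥0∞) = ENNReal.ofReal 4 by simp, ← ENNReal.ofReal_mul (by norm_num)]
        congr 1; ring
    _ ≤ ∑' b : u, 4 * ∫⁻ t in Metric.closedBall (b : ℝ) (s b), w t := by
        gcongr with b
        exact hs b (huE b.2)
    _ = 4 * ∫⁻ t in ⋃ b ∈ u, Metric.closedBall (b : ℝ) (s b), w t := by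
        rw [ENNReal.tsum_mul_left, lintegral_biUnion hcount
          (fun b _ => Metric.isClosed_closedBall.measurableSet) hdisj]
    _ ≤ 4 * ∫⁻ t, w t := by
        gcongr
        exact Measure.restrict_le_self

lemma lint_cube (d m : ℝ) (hd : 0 < d) (hm : 0 < m) :
    ∫⁻ s in Ioi m, ENNReal.ofReal (2 * d * s ^ (-3 : ℝ)) = ENNReal.ofReal (d / m ^ 2) := by
  rw [← ofReal_integral_eq_lintegral_ofReal]
  · rw [integral_const_mul, integral_Ioi_rpow_of_lt (by norm_num) hm]
    congr 1
    rw [show (-3 : ℝ) + 1 = -((2 : ℕ) : ℝ) by norm_num, Real.rpow_neg hm.le, Real.rpow_natCast]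
    field_simp
    norm_num
  · exact (integrableOn_Ioi_rpow_of_lt (by norm_num) hm).const_mul _
  · filter_upwards [self_mem_ae_restrict measurableSet_Ioi] with s hs
    have : 0 < s := hm.trans hs
    positivity

lemma lint_sq (d m : ℝ) (hd : 0 < d) (hm : 0 < m) :
    ∫⁻ s in Ioi m, ENNReal.ofReal (d * s ^ (-2 : ℝ)) = ENNReal.ofReal (d / m) := by
  rw [← ofReal_integral_eq_lintegral_ofReal]
  · rw [integral_const_mul, integral_Ioi_rpow_of_lt (by norm_num) hm]
    congr 1
    rw [show (-2 : ℝ) + 1 = -((1 : ℕ) : ℝ) by norm_num, Real.rpow_neg hm.le, Real.rpow_natCast]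
    field_simp
    norm_num
  · exact (integrableOn_Ioi_rpow_of_lt (by norm_num) hm).const_mul _
  · filter_upwards [self_mem_ae_restrict measurableSet_Ioi] with s hs
    have : 0 < s := hm.trans hs
    positivity

lemma kernel_le (w : ℝ → ℝ≥0∞) (hwm : Measurable w) (l x d : ℝ) (hl : 0 < l) (hd : 0 < d)
    (h : ∀ s : ℝ, 0 < s → ∫⁻ t in Metric.closedBall x s, w t ≤ ENNReal.ofReal (l * (2 * s))) :
    ∫⁻ t, ENNReal.ofReal (d / (d ^ 2 + (t - x) ^ 2)) * w t ≤ ENNReal.ofReal (4 * l) := by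
  let k : ℝ → ℝ → ℝ≥0∞ := fun t s =>
    ENNReal.ofReal (2 * d * s ^ (-3 : ℝ)) * (Metric.closedBall x s).indicator 1 t
  have hkm : Measurable (Function.uncurry k) := by
    have hS : MeasurableSet {q : ℝ × ℝ | dist q.1 x ≤ q.2} :=
      measurableSet_le (by fun_prop) (by fun_prop)
    have : Function.uncurry k = fun q : ℝ × ℝ => ENNReal.ofReal (2 * d * q.2 ^ (-3 : ℝ)) *
        {q : ℝ × ℝ | dist q.1 x ≤ q.2}.indicator 1 q := by
      ext q
      simp [k, Function.uncurry, indicator]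
    rw [this]
    exact Measurable.mul (by fun_prop) (measurable_one.indicator hS)
  have hk : ∀ t, ENNReal.ofReal (d / (d ^ 2 + (t - x) ^ 2)) ≤ ∫⁻ s in Ioi d, k t s := by
    intro t
    have hm : 0 < max d |t - x| := lt_max_of_lt_left hd
    calc ENNReal.ofReal (d / (d ^ 2 + (t - x) ^ 2))
        ≤ ENNReal.ofReal (d / (max d |t - x|) ^ 2) := by
          apply ENNReal.ofReal_le_ofReal
          gcongr
          rcases max_cases d |t - x| with ⟨h, _⟩ | ⟨h, _⟩ <;> rw [h]
          · nlinarith [sq_nonneg (t - x)]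
          · rw [sq_abs]; nlinarith [sq_nonneg d]
      _ = ∫⁻ s in Ioi (max d |t - x|), ENNReal.ofReal (2 * d * s ^ (-3 : ℝ)) :=
          (lint_cube d _ hd hm).symm
      _ = ∫⁻ s in Ioi (max d |t - x|), k t s := by
          apply setLIntegral_congr_fun measurableSet_Ioi
          intro s hs
          have : t ∈ Metric.closedBall x s := by
            rw [Metric.mem_closedBall, Real.dist_eq]
            exact (le_max_right _ _).trans (le_of_lt hs)
          simp only [k, indicator_of_mem this, Pi.one_apply, mul_one]
      _ ≤ ∫⁻ s in Ioi d, k t s :=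
          lintegral_mono_set (Ioi_subset_Ioi (le_max_left _ _))
  calc ∫⁻ t, ENNReal.ofReal (d / (d ^ 2 + (t - x) ^ 2)) * w t
      ≤ ∫⁻ t, (∫⁻ s in Ioi d, k t s) * w t := by
        gcongr with t; exact hk t
    _ = ∫⁻ t, ∫⁻ s in Ioi d, k t s * w t := by
        congr 1; ext t
        rw [lintegral_mul_const _ (by exact hkm.of_uncurry_left)]
    _ = ∫⁻ s in Ioi d, ∫⁻ t, k t s * w t := by
        rw [lintegral_lintegral_swap]
        exact (hkm.mul (hwm.comp measurable_fst)).aemeasurable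
    _ ≤ ∫⁻ s in Ioi d, ENNReal.ofReal (4 * l * d * s ^ (-2 : ℝ)) := by
        apply setLIntegral_mono' measurableSet_Ioi
        intro s hs
        have hs0 : 0 < s := hd.trans hs
        have e : ∫⁻ t, k t s * w t =
            ENNReal.ofReal (2 * d * s ^ (-3 : ℝ)) * ∫⁻ t in Metric.closedBall x s, w t := by
          rw [← lintegral_const_mul _ hwm, ← lintegral_indicator Metric.isClosed_closedBall.measurableSet]
          congr 1; ext t
          by_cases ht : t ∈ Metric.closedBall x s
          · simp only [k, indicator_of_mem ht, Pi.one_apply, mul_one]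
          · simp only [k, indicator_of_notMem ht, mul_zero, zero_mul]
        rw [e]
        calc _ ≤ ENNReal.ofReal (2 * d * s ^ (-3 : ℝ)) * ENNReal.ofReal (l * (2 * s)) := by
              gcongr; exact h s hs0
          _ = _ := by
              rw [← ENNReal.ofReal_mul (by positivity)]
              congr 1
              have : s ^ (-2 : ℝ) = s ^ (-3 : ℝ) * s := by
                rw [show (-2 : ℝ) = -3 + 1 by norm_num, Real.rpow_add hs0, Real.rpow_one]
              rw [this]; ring
    _ = ENNReal.ofReal (4 * l) := by
        rw [lint_sq _ _ (by positivity) hd]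
        congr 1; field_simp

lemma circlePt_eq (r θ : ℝ) : circlePt r θ = circleMap 0 r θ := by
  simp [circlePt, circleMap]

lemma norm_circlePt (r θ : ℝ) (hr : 0 ≤ r) : ‖circlePt r θ‖ = r := by
  rw [circlePt_eq]; simp [abs_of_nonneg hr]

lemma circleInt_poisson {E : Type*} [NormedAddCommGroup E] [NormedSpace ℝ E] (f : ℂ → E)
    (hf : ContinuousOn f (Metric.sphere 0 1)) (z : ℂ) (hz : z ∈ Metric.ball (0 : ℂ) 1) :
    CircleIntegrable (poissonKernel 0 z • f) 0 1 := by
  apply ContinuousOn.circleIntegrable (by norm_num)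
  apply ContinuousOn.smul _ hf
  unfold poissonKernel
  apply ContinuousOn.div (by fun_prop) (by fun_prop)
  intro x hx
  have : x ≠ z := by
    rintro rfl
    simp at hx hz
    linarith
  simp [sub_eq_zero, this]

lemma poisson_re (K : ℂ → ℂ) (hK : DiffContOnCl ℂ K (Metric.ball 0 1)) (z : ℂ)
    (hz : z ∈ Metric.ball (0 : ℂ) 1) :
    Real.circleAverage (fun ζ => poissonKernel 0 z ζ * (K ζ).re) 0 1 = (K z).re := by
  have hc : ContinuousOn K (Metric.sphere 0 1) := by
    apply hK.continuousOn.mono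
    rw [closure_ball _ (by norm_num)]
    exact Metric.sphere_subset_closedBall
  have h1 := hK.circleAverage_poissonKernel_smul hz
  have h2 := Complex.reCLM.circleAverage_comp_comm (circleInt_poisson K hc z hz)
  rw [h1] at h2
  rw [← Complex.reCLM_apply, ← h2]
  congr 1
  ext ζ
  simp

lemma dist_sq_circle (r θ t : ℝ) :
    ‖circleMap 0 1 t - circlePt r θ‖ ^ 2 = (1 - r) ^ 2 + 4 * r * Real.sin ((t - θ) / 2) ^ 2 := by
  have h : Real.sin ((t - θ) / 2) ^ 2 = (1 - Real.cos (t - θ)) / 2 := by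
    rw [Real.sin_sq_eq_half_sub]; ring_nf
  rw [h, Real.cos_sub, Complex.sq_norm, Complex.normSq_apply]
  simp only [circlePt, circleMap, Complex.exp_mul_I, zero_add, Complex.sub_re, Complex.sub_im,
    Complex.mul_re, Complex.mul_im, Complex.add_re, Complex.add_im, Complex.ofReal_re,
    Complex.ofReal_im, Complex.I_re, Complex.I_im, Complex.cos_ofReal_re, Complex.cos_ofReal_im,
    Complex.sin_ofReal_re, Complex.sin_ofReal_im]
  linear_combination (Real.sin_sq_add_cos_sq t) + r ^ 2 * (Real.sin_sq_add_cos_sq θ)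

lemma sin_sq_ge (y : ℝ) (hy : |y| ≤ π) : y ^ 2 / 10 ≤ Real.sin (y / 2) ^ 2 := by
  have h := Real.mul_le_sin (x := |y| / 2) (by positivity) (by linarith)
  have h2 : Real.sin (|y| / 2) ^ 2 = Real.sin (y / 2) ^ 2 := by
    rcases abs_cases y with ⟨h, _⟩ | ⟨h, _⟩ <;> rw [h]
    rw [neg_div, Real.sin_neg, neg_sq]
  rw [← h2]
  have h3 : (2 / π * (|y| / 2)) ^ 2 ≤ Real.sin (|y| / 2) ^ 2 := by
    gcongr
  refine le_trans ?_ h3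
  have : (2 / π * (|y| / 2)) ^ 2 = y ^ 2 / π ^ 2 := by
    rw [← sq_abs y]; field_simp
  rw [this]
  gcongr
  nlinarith [Real.pi_lt_d2, Real.pi_pos]

lemma poisson_kernel_bound (r θ t : ℝ) (hr : r ∈ Ico (0 : ℝ) 1) (ht : |t - θ| ≤ π) :
    poissonKernel 0 (circlePt r θ) (circleMap 0 1 t) ≤
      160 * ((1 - r) / ((1 - r) ^ 2 + (t - θ) ^ 2)) := by
  obtain ⟨h0, h1⟩ := hr
  rw [poissonKernel_def]
  simp only [sub_zero]
  rw [dist_sq_circle, norm_circlePt _ _ h0]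
  have e : ‖circleMap 0 1 t‖ = 1 := by simp
  rw [e]
  have hs := sin_sq_ge _ ht
  have hy : (t - θ) ^ 2 ≤ 10 := by
    rw [← sq_abs]
    have := abs_nonneg (t - θ)
    nlinarith [Real.pi_lt_d2, Real.pi_pos]
  have hd : 0 < 1 - r := by linarith
  have key : (1 - r) ^ 2 + (t - θ) ^ 2 ≤
      80 * ((1 - r) ^ 2 + 4 * r * Real.sin ((t - θ) / 2) ^ 2) := by
    rcases le_total r (1 / 2) with h | h
    · have : 0 ≤ 4 * r * Real.sin ((t - θ) / 2) ^ 2 := by positivity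
      nlinarith
    · have : 4 * (1/2) * ((t - θ) ^ 2 / 10) ≤ 4 * r * Real.sin ((t - θ) / 2) ^ 2 := by
        gcongr
      nlinarith [sq_nonneg (1 - r), sq_nonneg (t - θ)]
  have hA : 0 < (1 - r) ^ 2 + (t - θ) ^ 2 := by positivity
  have hB : 0 < (1 - r) ^ 2 + 4 * r * Real.sin ((t - θ) / 2) ^ 2 := by linarith
  rw [← mul_div_assoc, div_le_div_iff₀ hB hA]
  calc (1 ^ 2 - r ^ 2) * ((1 - r) ^ 2 + (t - θ) ^ 2)
      ≤ (2 * (1 - r)) * (80 * ((1 - r) ^ 2 + 4 * r * Real.sin ((t - θ) / 2) ^ 2)) := by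
        gcongr
        nlinarith
    _ = _ := by ring

lemma poissonKernel_nonneg' (r θ t : ℝ) (hr : r ∈ Ico (0 : ℝ) 1) :
    0 ≤ poissonKernel 0 (circlePt r θ) (circleMap 0 1 t) := by
  rw [poissonKernel_def]
  simp only [sub_zero]
  rw [norm_circlePt _ _ hr.1]
  have e : ‖circleMap 0 1 t‖ = 1 := by simp
  rw [e]
  apply div_nonneg _ (by positivity)
  nlinarith [hr.1, hr.2]

lemma fatou_weak (K : ℂ → ℂ) (hK : DiffContOnCl ℂ K (Metric.ball 0 1))
    (hpos : ∀ z ∈ Metric.closedBall (0 : ℂ) 1, 0 ≤ (K z).re) (l : ℝ) (hl : 0 < l) :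
    ENNReal.ofReal l * volume {θ : ℝ | θ ∈ Ioc 0 (2 * π) ∧
      ∃ r ∈ Ico (0 : ℝ) 1, 640 * l < (K (circlePt r θ)).re} ≤
      4 * (ENNReal.ofReal (4 * π * (K 0).re)) := by
  have hcl : ContinuousOn K (Metric.closedBall 0 1) := by
    have := hK.continuousOn
    rwa [closure_ball _ (by norm_num)] at this
  let f : ℝ → ℝ := fun t => (K (circleMap 0 1 t)).re
  have hf : Continuous f := by
    apply Complex.continuous_re.comp
    exact hcl.comp_continuous (continuous_circleMap 0 1) (fun t => by simp)
  have hf0 : ∀ t, 0 ≤ f t := fun t => hpos _ (by simp)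
  have hper : Function.Periodic f (2 * π) := fun t => by
    simp only [f, periodic_circleMap 0 1 t]
  have hf2 : ∫ t in (0)..(2 * π), f t = 2 * π * (K 0).re := by
    have h := poisson_re K hK 0 (by simp)
    have : ∀ ζ ∈ Metric.sphere (0 : ℂ) |1|, poissonKernel 0 0 ζ * (K ζ).re = (K ζ).re := by
      intro ζ hζ
      have : ‖ζ‖ = 1 := by simpa using hζ
      simp [poissonKernel_def, this]
    rw [Real.circleAverage_congr_sphere this, Real.circleAverage_def, smul_eq_mul] at h
    rw [← h]
    field_simp
    rfl
  let w : ℝ → ℝ≥0∞ := (Ioc (-π) (3 * π)).indicator fun t => ENNReal.ofReal (f t)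
  have hwm : Measurable w :=
    (ENNReal.measurable_ofReal.comp hf.measurable).indicator measurableSet_Ioc
  have hwi : ∫⁻ t, w t = ENNReal.ofReal (4 * π * (K 0).re) := by
    have hle : -π ≤ 3 * π := by linarith [Real.pi_pos]
    rw [lintegral_indicator measurableSet_Ioc, ← ofReal_integral_eq_lintegral_ofReal
      (hf.integrableOn_Ioc) (Eventually.of_forall hf0), ← intervalIntegral.integral_of_le hle,
      ← intervalIntegral.integral_add_adjacent_intervals (b := π)
      (hf.intervalIntegrable _ _) (hf.intervalIntegrable _ _)]
    have e1 := hper.intervalIntegral_add_eq (-π) 0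
    have e2 := hper.intervalIntegral_add_eq π 0
    rw [show -π + 2 * π = π by ring, zero_add] at e1
    rw [show π + 2 * π = 3 * π by ring, zero_add] at e2
    rw [e1, e2, hf2]
    congr 1; ring
  rw [← hwi]
  apply hl_weak w (by rw [hwi]; exact ENNReal.ofReal_ne_top) l hl
  rintro θ ⟨hθ, r, hr, hlt⟩
  by_contra! hcon
  have h1 := kernel_le w hwm l θ (1 - r) hl (by linarith [hr.2]) (fun s hs => (hcon s hs).le)
  have hz : circlePt r θ ∈ Metric.ball (0 : ℂ) 1 := by
    simp [norm_circlePt r θ hr.1, hr.2]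
  have h2 := poisson_re K hK _ hz
  let g : ℝ → ℝ := fun t => poissonKernel 0 (circlePt r θ) (circleMap 0 1 t) * f t
  have hgper : Function.Periodic g (2 * π) := fun t => by
    simp only [g, f, periodic_circleMap 0 1 t]
  have h3 : (K (circlePt r θ)).re = (2 * π)⁻¹ * ∫ t in (θ - π)..(θ + π), g t := by
    rw [← h2, Real.circleAverage_def, smul_eq_mul]
    have e := hgper.intervalIntegral_add_eq (θ - π) 0
    rw [show θ - π + 2 * π = θ + π by ring, zero_add] at e
    rw [e]
  have hle : θ - π ≤ θ + π := by linarith [Real.pi_pos]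
  have h4 : (K (circlePt r θ)).re ≤ ∫ t in (θ - π)..(θ + π), g t := by
    rw [h3]
    have : 0 ≤ ∫ t in (θ - π)..(θ + π), g t :=
      intervalIntegral.integral_nonneg hle fun t _ =>
        mul_nonneg (poissonKernel_nonneg' r θ t hr) (hf0 t)
    apply mul_le_of_le_one_left this
    apply inv_le_one_of_one_le₀
    linarith [Real.pi_gt_three]
  let k : ℝ → ℝ := fun t => (1 - r) / ((1 - r) ^ 2 + (t - θ) ^ 2)
  have hd : 0 < 1 - r := by linarith [hr.2]
  have hkc : Continuous k := by
    apply Continuous.div (by fun_prop) (by fun_prop)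
    intro t
    positivity
  have h5 : ENNReal.ofReal (∫ t in (θ - π)..(θ + π), k t * f t) ≤ ENNReal.ofReal (4 * l) := by
    refine le_trans ?_ h1
    have hkf_int : IntegrableOn (fun t => k t * f t) (Ioc (θ - π) (θ + π)) :=
      (hkc.mul hf).integrableOn_Ioc
    rw [intervalIntegral.integral_of_le hle, ofReal_integral_eq_lintegral_ofReal hkf_int
      (Eventually.of_forall fun t => mul_nonneg (by simp only [k]; positivity) (hf0 t))]
    refine le_trans ?_ (setLIntegral_le_lintegral (Ioc (θ - π) (θ + π)) _)
    apply setLIntegral_mono' measurableSet_Ioc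
    intro t ht
    have : t ∈ Ioc (-π) (3 * π) := ⟨by linarith [ht.1, hθ.1], by linarith [ht.2, hθ.2]⟩
    simp only [w, indicator_of_mem this]
    rw [← ENNReal.ofReal_mul (by positivity)]
  have h6 : ∫ t in (θ - π)..(θ + π), k t * f t ≤ 4 * l :=
    (ENNReal.ofReal_le_ofReal_iff (by positivity)).1 h5
  have h7 : ∫ t in (θ - π)..(θ + π), g t ≤ ∫ t in (θ - π)..(θ + π), 160 * (k t * f t) := by
    apply intervalIntegral.integral_mono_on hle
    · have := circleInt_poisson (fun ζ => (K ζ).re) (Complex.continuous_re.comp_continuousOn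
        (hcl.mono Metric.sphere_subset_closedBall)) _ hz
      have h8 : IntervalIntegrable g volume 0 (2 * π) := this
      exact hgper.intervalIntegrable₀ (by positivity) h8 _ _
    · exact ((hkc.mul hf).const_mul 160).intervalIntegrable _ _
    · intro t ht
      rw [← mul_assoc]
      apply mul_le_mul_of_nonneg_right _ (hf0 t)
      apply poisson_kernel_bound r θ t hr
      rw [abs_le]; constructor <;> linarith [ht.1, ht.2]
  rw [intervalIntegral.integral_const_mul] at h7
  linarith

lemma sqrt_facts (x : ℂ) (hx : 0 < x.re) :
    (x ^ (((2 : ℕ) : ℂ)⁻¹)) ^ 2 = x ∧ 0 ≤ (x ^ (((2 : ℕ) : ℂ)⁻¹)).re ∧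
      ‖x‖ ≤ 2 * (x ^ (((2 : ℕ) : ℂ)⁻¹)).re ^ 2 := by
  have h1 : (x ^ (((2 : ℕ) : ℂ)⁻¹)) ^ 2 = x := Complex.cpow_nat_inv_pow x two_ne_zero
  have hx0 : x ≠ 0 := by rintro rfl; simp at hx
  refine ⟨h1, ?_, ?_⟩
  · rw [Complex.cpow_def_of_ne_zero hx0, Complex.exp_re]
    apply mul_nonneg (Real.exp_pos _).le
    apply Real.cos_nonneg_of_mem_Icc
    have e : (Complex.log x * ((2 : ℕ) : ℂ)⁻¹).im = Complex.arg x / 2 := by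
      rw [← div_eq_mul_inv, Complex.div_natCast_im, Complex.log_im]; norm_num
    rw [e]
    constructor <;> linarith [Complex.neg_pi_lt_arg x, Complex.arg_le_pi x]
  · set y := x ^ (((2 : ℕ) : ℂ)⁻¹)
    have h2 : ‖x‖ = y.re ^ 2 + y.im ^ 2 := by
      rw [← h1, norm_pow, Complex.sq_norm, Complex.normSq_apply]; ring
    have h3 : x.re = y.re ^ 2 - y.im ^ 2 := by
      rw [← h1, sq, Complex.mul_re]; ring
    nlinarith

lemma fatou_weak_disk (K : ℂ → ℂ) (hK : DifferentiableOn ℂ K unitDisk)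
    (hpos : ∀ z ∈ unitDisk, 0 ≤ (K z).re) (l : ℝ) (hl : 0 < l) :
    ENNReal.ofReal l * volume {θ : ℝ | θ ∈ Ioc 0 (2 * π) ∧
      ∃ r ∈ Ico (0 : ℝ) 1, 640 * l < (K (circlePt r θ)).re} ≤
      4 * (ENNReal.ofReal (4 * π * (K 0).re)) := by
  let R : ℕ → ℝ := fun k => 1 - 1 / ((k : ℝ) + 2)
  have hR0 : ∀ k, 0 < R k := fun k => by
    simp only [R]
    rw [sub_pos, div_lt_one (by positivity)]
    have : (0 : ℝ) ≤ k := by positivity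
    linarith
  have hR1 : ∀ k, R k < 1 := fun k => by
    simp only [R]
    have : 0 < 1 / ((k : ℝ) + 2) := by positivity
    linarith
  have hRm : Monotone R := by
    intro i j hij
    simp only [R]
    gcongr
  have hRt : Tendsto R atTop (𝓝 1) := by
    have : Tendsto (fun k : ℕ => 1 / ((k : ℝ) + 2)) atTop (𝓝 0) :=
      tendsto_const_nhds.div_atTop (tendsto_atTop_add_const_right _ _ tendsto_natCast_atTop_atTop)
    simpa [R] using this.const_sub 1
  let A : ℕ → Set ℝ := fun k => {θ : ℝ | θ ∈ Ioc 0 (2 * π) ∧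
      ∃ r ∈ Ico (0 : ℝ) (R k), 640 * l < (K (circlePt r θ)).re}
  have hAm : Monotone A := by
    rintro i j hij θ ⟨hθ, r, hr, h⟩
    exact ⟨hθ, r, ⟨hr.1, hr.2.trans_le (hRm hij)⟩, h⟩
  have hsub : {θ : ℝ | θ ∈ Ioc 0 (2 * π) ∧
      ∃ r ∈ Ico (0 : ℝ) 1, 640 * l < (K (circlePt r θ)).re} ⊆ ⋃ k, A k := by
    rintro θ ⟨hθ, r, hr, h⟩
    obtain ⟨k, hk⟩ := (hRt.eventually (lt_mem_nhds hr.2)).exists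
    exact mem_iUnion.2 ⟨k, hθ, r, ⟨hr.1, hk⟩, h⟩
  have hA : ∀ k, ENNReal.ofReal l * volume (A k) ≤ 4 * (ENNReal.ofReal (4 * π * (K 0).re)) := by
    intro k
    have hmem : ∀ z ∈ Metric.closedBall (0 : ℂ) 1, (R k : ℂ) * z ∈ unitDisk := by
      intro z hz
      simp only [unitDisk, Metric.mem_ball, dist_zero_right, norm_mul, Complex.norm_real,
        Real.norm_eq_abs, abs_of_pos (hR0 k)]
      have : ‖z‖ ≤ 1 := by simpa using hz
      nlinarith [hR0 k, hR1 k, norm_nonneg z]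
    have hd : DifferentiableOn ℂ (fun z => K ((R k : ℂ) * z)) (Metric.closedBall 0 1) :=
      hK.comp (by fun_prop) hmem
    have hd' : DiffContOnCl ℂ (fun z => K ((R k : ℂ) * z)) (Metric.ball 0 1) := by
      apply DifferentiableOn.diffContOnCl
      rwa [closure_ball _ (by norm_num)]
    have := fatou_weak _ hd' (fun z hz => hpos _ (hmem z hz)) l hl
    simp only [mul_zero] at this
    refine le_trans ?_ this
    gcongr
    rintro θ ⟨hθ, r, hr, h⟩
    refine ⟨hθ, r / R k, ⟨div_nonneg hr.1 (hR0 k).le, (div_lt_one (hR0 k)).2 hr.2⟩, ?_⟩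
    have e : (R k : ℂ) * circlePt (r / R k) θ = circlePt r θ := by
      simp only [circlePt]
      rw [← mul_assoc, ← Complex.ofReal_mul, mul_div_cancel₀ _ (hR0 k).ne']
    rw [e]; exact h
  calc _ ≤ ENNReal.ofReal l * volume (⋃ k, A k) := by gcongr
    _ = ⨆ k, ENNReal.ofReal l * volume (A k) := by
        rw [hAm.measure_iUnion, ENNReal.mul_iSup]
    _ ≤ _ := iSup_le hA

lemma fatou_ae (Q : ℂ → ℂ) (hQ : DifferentiableOn ℂ Q unitDisk)
    (hpos : ∀ z ∈ unitDisk, 0 ≤ (Q z).re) :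
    ∀ᵐ θ ∂(volume.restrict (Ioc 0 (2 * π))),
      ∃ B : ℝ, ∀ r ∈ Ico (0 : ℝ) 1, ‖Q (circlePt r θ)‖ ≤ B := by
  let K : ℂ → ℂ := fun z => (Q z + 1) ^ (((2 : ℕ) : ℂ)⁻¹)
  have hre : ∀ z ∈ unitDisk, 0 < (Q z + 1).re := fun z hz => by
    simp only [Complex.add_re, Complex.one_re]; linarith [hpos z hz]
  have hK : DifferentiableOn ℂ K unitDisk :=
    (hQ.add_const 1).cpow (differentiableOn_const _) fun z hz => Or.inl (hre z hz)
  rw [ae_restrict_iff' measurableSet_Ioc, ae_iff]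
  set N := {θ : ℝ | ¬ (θ ∈ Ioc 0 (2 * π) →
      ∃ B : ℝ, ∀ r ∈ Ico (0 : ℝ) 1, ‖Q (circlePt r θ)‖ ≤ B)} with hN
  have hb : ∀ n : ℕ, ((n : ℝ≥0∞) + 1) * volume N ≤ 4 * (ENNReal.ofReal (4 * π * (K 0).re)) := by
    intro n
    refine le_trans ?_ (fatou_weak_disk K hK (fun z hz => (sqrt_facts _ (hre z hz)).2.1)
      ((n : ℝ) + 1) (by positivity))
    have e : ENNReal.ofReal ((n : ℝ) + 1) = (n : ℝ≥0∞) + 1 := by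
      rw [ENNReal.ofReal_add (by positivity) (by norm_num)]; simp
    rw [e]
    gcongr
    intro θ hθ
    rw [hN, mem_ofPred_eq, Classical.not_imp, not_exists] at hθ
    obtain ⟨h1, h2⟩ := hθ
    refine ⟨h1, ?_⟩
    by_contra! hc
    apply h2 (2 * (640 * ((n : ℝ) + 1)) ^ 2 + 1)
    intro r hr
    have hz : circlePt r θ ∈ unitDisk := by
      simp [unitDisk, norm_circlePt r θ hr.1, hr.2]
    obtain ⟨-, h4, h5⟩ := sqrt_facts _ (hre _ hz)
    have h6 := hc r hr
    have h7 : ‖Q (circlePt r θ) + 1‖ ≤ 2 * (640 * ((n : ℝ) + 1)) ^ 2 := by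
      refine h5.trans ?_
      gcongr
    calc ‖Q (circlePt r θ)‖ = ‖(Q (circlePt r θ) + 1) - 1‖ := by simp
      _ ≤ ‖Q (circlePt r θ) + 1‖ + ‖(1 : ℂ)‖ := norm_sub_le _ _
      _ ≤ _ := by rw [norm_one]; linarith
  by_contra hne
  have hC : 4 * (ENNReal.ofReal (4 * π * (K 0).re)) ≠ ∞ :=
    ENNReal.mul_ne_top (by norm_num) ENNReal.ofReal_ne_top
  obtain ⟨n, hn⟩ := ENNReal.exists_nat_mul_gt hne hC
  have : (n : ℝ≥0∞) * volume N ≤ ((n : ℝ≥0∞) + 1) * volume N := by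
    gcongr; exact le_self_add
  exact absurd (this.trans (hb n)) (not_le.2 hn)

lemma circlePt_mem (r θ : ℝ) (hr : r ∈ Ico (0 : ℝ) 1) : circlePt r θ ∈ unitDisk := by
  simp [unitDisk, norm_circlePt r θ hr.1, hr.2]

lemma measurable_maxRad (f : ℂ → ℂ) (hf : DifferentiableOn ℂ f unitDisk) :
    Measurable (maxRad f) := by
  apply LowerSemicontinuous.measurable
  apply lowerSemicontinuous_biSup
  intro r hr
  apply Continuous.lowerSemicontinuous
  have : Continuous fun θ => f (circlePt r θ) :=
    hf.continuousOn.comp_continuous (by unfold circlePt; fun_prop) (fun θ => circlePt_mem r θ hr)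
  exact ENNReal.continuous_coe.comp this.nnnorm

lemma measurable_elogPlus : Measurable elogPlus := by
  unfold elogPlus
  apply Measurable.ite (measurableSet_singleton ∞) measurable_const
  fun_prop

lemma measurable_elog1p : Measurable elog1p := by
  unfold elog1p
  apply Measurable.ite (measurableSet_singleton ∞) measurable_const
  fun_prop

lemma elogPlus_le (x y : ℝ≥0∞) (h : x ≤ max 1 y) : elogPlus x ≤ elogPlus y := by
  unfold elogPlus
  by_cases hy : y = ∞
  · simp [hy]
  have hx : x ≠ ∞ := ne_top_of_le_ne_top (by simp [hy]) h
  rw [if_neg hx, if_neg hy]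
  rcases le_total y 1 with h1 | h1
  · rw [max_eq_left h1] at h
    rw [ENNReal.ofReal_of_nonpos]
    · exact zero_le
    · exact Real.log_nonpos ENNReal.toReal_nonneg
        (by simpa using ENNReal.toReal_mono ENNReal.one_ne_top h)
  · rw [max_eq_right h1] at h
    rcases eq_or_ne x 0 with rfl | h0
    · simp
    apply ENNReal.ofReal_le_ofReal
    exact Real.log_le_log (ENNReal.toReal_pos h0 hx) (ENNReal.toReal_mono hy h)

lemma elog1p_le (x y : ℝ≥0∞) (h : x ≤ 1 + max 1 y) :
    elog1p x ≤ ENNReal.ofReal (Real.log 3) + elogPlus y := by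
  by_cases hy : y = ∞
  · simp [hy, elogPlus]
  have hm : max 1 y ≠ ∞ := by simp [hy]
  have hm' : 1 + max 1 y ≠ ∞ := by simp [hy]
  have hx : x ≠ ∞ := ne_top_of_le_ne_top hm' h
  refine le_trans ?_ (add_le_add_right (elogPlus_le (max 1 y) y le_rfl) _)
  unfold elog1p elogPlus
  rw [if_neg hx, if_neg hm]
  have h1 : 1 ≤ (max 1 y).toReal := by
    simpa using ENNReal.toReal_mono hm (le_max_left 1 y)
  have h2 : x.toReal ≤ 1 + (max 1 y).toReal := by
    have := ENNReal.toReal_mono hm' h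
    rwa [ENNReal.toReal_add ENNReal.one_ne_top hm, ENNReal.toReal_one] at this
  rw [← ENNReal.ofReal_add (Real.log_nonneg (by norm_num)) (Real.log_nonneg h1),
    ← Real.log_mul (by norm_num) (by linarith)]
  apply ENNReal.ofReal_le_ofReal
  apply Real.log_le_log
  · have : 0 ≤ x.toReal := ENNReal.toReal_nonneg
    linarith
  · linarith

lemma elog1p_le_self (x : ℝ≥0∞) : elog1p x ≤ x := by
  unfold elog1p
  split_ifs with h
  · rw [h]
  · apply ENNReal.ofReal_le_of_le_toReal
    have : 0 ≤ x.toReal := ENNReal.toReal_nonneg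
    have := Real.log_le_sub_one_of_pos (x := 1 + x.toReal) (by linarith)
    linarith

lemma exists_log_disk (F : ℂ → ℂ) (hF : DifferentiableOn ℂ F unitDisk)
    (hz : ∀ z ∈ unitDisk, F z ≠ 0) :
    ∃ G : ℂ → ℂ, DifferentiableOn ℂ G unitDisk ∧ ∀ z ∈ unitDisk, Complex.exp (G z) = F z := by
  have ho : IsOpen unitDisk := Metric.isOpen_ball
  have h0 : (0 : ℂ) ∈ unitDisk := by simp [unitDisk]
  have hd : DifferentiableOn ℂ (fun z => deriv F z / F z) unitDisk :=
    (hF.deriv ho).div hF hz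
  obtain ⟨G, hG0, hG⟩ := (DifferentiableOn.isExactOn_ball hd).with_val_at 0 (Complex.log (F 0))
  refine ⟨G, fun z hz' => (hG z hz').differentiableAt.differentiableWithinAt, ?_⟩
  have hder : ∀ z ∈ unitDisk, HasDerivAt (fun z => F z * Complex.exp (-G z)) 0 z := by
    intro z hz'
    have h1 : HasDerivAt F (deriv F z) z := (hF.differentiableAt (ho.mem_nhds hz')).hasDerivAt
    have h2 := h1.mul ((hG z hz').neg.cexp)
    have e : deriv F z * Complex.exp (-G z) +
        F z * (Complex.exp (-G z) * -(deriv F z / F z)) = 0 := by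
      have := hz z hz'
      field_simp
      ring
    rw [← e]
    exact h2
  have hconst : ∀ z ∈ unitDisk, F z * Complex.exp (-G z) = F 0 * Complex.exp (-G 0) := by
    intro z hz'
    apply (convex_ball (0 : ℂ) 1).is_const_of_fderivWithin_eq_zero (𝕜 := ℂ)
      (f := fun z => F z * Complex.exp (-G z)) _ _ hz' h0
    · exact fun z hz' => (hder z hz').differentiableAt.differentiableWithinAt
    · intro z hz'
      rw [fderivWithin_of_isOpen Metric.isOpen_ball hz']
      ext
      simp [(hder z hz').deriv]
  intro z hz'
  have h := hconst z hz'
  rw [hG0, Complex.exp_neg, Complex.exp_neg, Complex.exp_log (hz 0 h0),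
    mul_inv_cancel₀ (hz 0 h0)] at h
  have := Complex.exp_ne_zero (G z)
  field_simp at h
  exact h.symm

lemma log_radially_bounded (p : ℝ) (hp : 1 < p) (F : ℂ → ℂ) (hF : F ∈ MpClass p)
    (G : ℂ → ℂ) (hG : DifferentiableOn ℂ G unitDisk)
    (hGF : ∀ z ∈ unitDisk, Complex.exp (G z) = F z) 
    (hfin : ∫⁻ θ in Ioc 0 (2 * π), elogPlus (maxRad F θ) ^ p ≠ ∞) :
    ∀ᵐ θ ∂(volume.restrict (Ioc 0 (2 * π))),
      ∃ B : ℝ, ∀ r ∈ Ico (0 : ℝ) 1, ‖G (circlePt r θ)‖ ≤ B := by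
  let H : ℝ → ℝ≥0∞ := fun θ => elogPlus (maxRad F θ)
  have hHm : Measurable H := measurable_elogPlus.comp (measurable_maxRad F hF.1)
  have hH1 : ∫⁻ θ in Ioc 0 (2 * π), H θ ≠ ∞ := by
    have : ∫⁻ θ in Ioc 0 (2 * π), H θ ≤ ∫⁻ θ in Ioc 0 (2 * π), (1 + H θ ^ p) := by
      gcongr with θ
      rcases le_total (H θ) 1 with h | h
      · exact h.trans le_self_add
      · refine le_trans ?_ le_add_self
        exact ENNReal.le_rpow_self_of_one_le h hp.le
    refine ne_top_of_le_ne_top ?_ this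
    rw [lintegral_add_left measurable_const]
    simp only [lintegral_const, one_mul]
    apply ENNReal.add_ne_top.2 ⟨_, hfin⟩
    exact measure_ne_top _ _
  let g : ℂ → ℝ := fun ζ =>
    (elogPlus (⨆ r ∈ Set.Ico (0 : ℝ) 1, (‖F ((r : ℂ) * ζ)‖₊ : ℝ≥0∞))).toReal
  have hgH : ∀ θ, g (circleMap 0 1 θ) = (H θ).toReal := by
    intro θ
    simp only [g, H, maxRad, circlePt, circleMap]
    simp
  have hg0 : ∀ ζ, 0 ≤ g ζ := fun ζ => ENNReal.toReal_nonneg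
  have hpi : (0 : ℝ) ≤ 2 * π := by positivity
  have hgi : CircleIntegrable g 0 1 := by
    unfold CircleIntegrable
    rw [intervalIntegrable_iff, uIoc_of_le hpi]
    simp only [hgH]
    exact integrable_toReal_of_lintegral_ne_top hHm.aemeasurable hH1
  have hgi' : CircleIntegrable (fun ζ => (g ζ : ℂ)) 0 1 := by
    simp only [CircleIntegrable, intervalIntegrable_iff] at hgi ⊢
    exact Complex.ofRealCLM.integrable_comp hgi
  let G2 : ℂ → ℂ := fun w =>
    Real.circleAverage (fun ζ => herglotzRieszKernel 0 w ζ • (g ζ : ℂ)) 0 1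
  have hG2 : DifferentiableOn ℂ G2 unitDisk :=
    differentiableOn_circleAverage_herglotzRieszKernel_smul hgi'
  have hre : ∀ w ∈ unitDisk, (G2 w).re = Real.circleAverage (poissonKernel 0 w • g) 0 1 := by
    intro w hw
    rw [poissonKernel_eq_re_herglotzRieszKernel]
    exact re_circleAverage_herglotzRieszKernel_smul hgi hw
  have hPn : ∀ w ∈ unitDisk, ∀ ζ ∈ Metric.sphere (0 : ℂ) 1, 0 ≤ poissonKernel 0 w ζ := by
    intro w hw ζ hζ
    have h1 : ‖ζ‖ = 1 := by simpa using hζ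
    have h2 : ‖w‖ < 1 := by simpa [unitDisk] using hw
    rw [poissonKernel_def]
    simp only [sub_zero, h1]
    apply div_nonneg _ (by positivity)
    nlinarith [norm_nonneg w]
  have hpos2 : ∀ w ∈ unitDisk, 0 ≤ (G2 w).re := by
    intro w hw
    rw [hre w hw]
    apply Real.circleAverage_nonneg_of_nonneg
    intro ζ hζ
    rw [abs_one] at hζ
    exact mul_nonneg (hPn w hw ζ hζ) (hg0 ζ)
  have hPgi : ∀ w ∈ unitDisk, CircleIntegrable (poissonKernel 0 w • g) 0 1 := by
    intro w hw
    have hc := circleInt_poisson (fun _ => (1 : ℝ)) continuousOn_const w hw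
    have hcc : ContinuousOn (fun ζ => poissonKernel 0 w ζ) (Metric.sphere 0 1) := by
      unfold poissonKernel
      apply ContinuousOn.div (by fun_prop) (by fun_prop)
      intro x hx
      have : x ≠ w := by
        rintro rfl
        simp [unitDisk] at hx hw
        linarith
      simp [sub_eq_zero, this]
    unfold CircleIntegrable at hgi ⊢
    apply hgi.continuousOn_mul
    apply Continuous.continuousOn
    exact hcc.comp_continuous (continuous_circleMap 0 1) (fun t => by simp)
  have hmaj : ∀ R ∈ Ico (0 : ℝ) 1, ∀ z ∈ unitDisk, (G ((R : ℂ) * z)).re ≤ (G2 z).re := by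
    intro R hR z hz
    have hmem : ∀ z ∈ Metric.closedBall (0 : ℂ) 1, (R : ℂ) * z ∈ unitDisk := by
      intro z hz
      simp only [unitDisk, Metric.mem_ball, dist_zero_right, norm_mul, Complex.norm_real,
        Real.norm_eq_abs, abs_of_nonneg hR.1]
      have : ‖z‖ ≤ 1 := by simpa using hz
      nlinarith [hR.1, hR.2, norm_nonneg z]
    have hd : DifferentiableOn ℂ (fun z => G ((R : ℂ) * z)) (Metric.closedBall 0 1) :=
      hG.comp (by fun_prop) hmem
    have hd' : DiffContOnCl ℂ (fun z => G ((R : ℂ) * z)) (Metric.ball 0 1) := by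
      apply DifferentiableOn.diffContOnCl
      rwa [closure_ball _ (by norm_num)]
    rw [hre z hz]
    have hp1 := poisson_re _ hd' z hz
    rw [← hp1, Real.circleAverage_def, Real.circleAverage_def, smul_eq_mul, smul_eq_mul]
    apply mul_le_mul_of_nonneg_left _ (by positivity)
    apply intervalIntegral.integral_mono_ae_restrict hpi
    · exact circleInt_poisson (fun ζ => (G ((R : ℂ) * ζ)).re)
        (Complex.continuous_re.comp_continuousOn
        (hd.continuousOn.mono Metric.sphere_subset_closedBall)) z hz
    · exact hPgi z hz
    · rw [← restrict_Ioc_eq_restrict_Icc]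
      filter_upwards [ae_lt_top hHm hH1] with θ hθ
      apply mul_le_mul_of_nonneg_left _ (hPn z hz _ (by simp))
      rw [hgH]
      have hM : maxRad F θ ≠ ∞ := by
        intro h
        simp [H, h, elogPlus] at hθ
      have hzz : circlePt R θ ∈ unitDisk := circlePt_mem R θ hR
      have e : (R : ℂ) * circleMap 0 1 θ = circlePt R θ := by simp [circlePt, circleMap]
      simp only [e, H, elogPlus, if_neg hM]
      have h1 : ‖F (circlePt R θ)‖ ≤ (maxRad F θ).toReal := by
        have : (‖F (circlePt R θ)‖₊ : ℝ≥0∞) ≤ maxRad F θ :=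
          le_biSup (fun r => (‖F (circlePt r θ)‖₊ : ℝ≥0∞)) hR
        simpa using ENNReal.toReal_mono hM this
      rw [← hGF _ hzz, Complex.norm_exp] at h1
      have h2 := Real.log_le_log (Real.exp_pos _) h1
      rw [Real.log_exp] at h2
      rw [ENNReal.toReal_ofReal']
      exact h2.trans (le_max_left _ _)
  have hmaj1 : ∀ z ∈ unitDisk, (G z).re ≤ (G2 z).re := by
    intro z hz
    have ht : Tendsto (fun R : ℝ => (G ((R : ℂ) * z)).re) (𝓝[<] 1) (𝓝 (G z).re) := by
      have hc : ContinuousAt G z :=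
        (hG.differentiableAt (Metric.isOpen_ball.mem_nhds hz)).continuousAt
      have h1 : Tendsto (fun R : ℝ => (R : ℂ) * z) (𝓝[<] 1) (𝓝 z) := by
        have : Continuous fun R : ℝ => (R : ℂ) * z := by fun_prop
        have h := this.tendsto 1
        simp only [Complex.ofReal_one, one_mul] at h
        exact h.mono_left nhdsWithin_le_nhds
      exact (Complex.continuous_re.tendsto _).comp (hc.tendsto.comp h1)
    refine le_of_tendsto ht ?_
    filter_upwards [Ico_mem_nhdsLT (zero_lt_one (α := ℝ))] with R hR
    exact hmaj R hR z hz
  filter_upwards [fatou_ae G2 hG2 hpos2, fatou_ae (fun z => G2 z - G z) (hG2.sub hG)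
    (fun z hz => by simpa using hmaj1 z hz)] with θ h1 h2
  obtain ⟨B1, h1⟩ := h1
  obtain ⟨B2, h2⟩ := h2
  refine ⟨B1 + B2, fun r hr => ?_⟩
  have e : G (circlePt r θ) = G2 (circlePt r θ) - (G2 (circlePt r θ) - G (circlePt r θ)) := by ring
  rw [e]
  exact (norm_sub_le _ _).trans (add_le_add (h1 r hr) (h2 r hr))


/-- If `F ∈ M^p` is zero-free on the unit disk, then there is a sequence
`F_n ∈ M^p` with `(F_n)^n = F` for every positive integer `n` and `F_n → 1` in `(M^p, ρ_p)`. -/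
theorem exists_roots_tendsto_one (p : ℝ) (hp : 1 < p)
    (F : ℂ → ℂ) (hF : F ∈ MpClass p) (hz : ∀ z ∈ unitDisk, F z ≠ 0) :
    ∃ Fn : ℕ → ℂ → ℂ,
      (∀ n : ℕ, 1 ≤ n → Fn n ∈ MpClass p ∧ ∀ z ∈ unitDisk, (Fn n z) ^ n = F z) ∧
      Tendsto (fun n => rhoMetric p (Fn n) 1) atTop (nhds 0) := by
  have hpi : (0 : ℝ) < 2 * π := by positivity
  have hfin : ∫⁻ θ in Ioc 0 (2 * π), elogPlus (maxRad F θ) ^ p ≠ ∞ := by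
    intro h
    have := hF.2
    rw [h, ENNReal.top_div_of_ne_top ENNReal.ofReal_ne_top] at this
    exact lt_irrefl _ this
  obtain ⟨G, hG, hGF⟩ := exists_log_disk F hF.1 hz
  have hbdd := log_radially_bounded p hp F hF G hG hGF hfin
  let Fn : ℕ → ℂ → ℂ := fun n z => Complex.exp (G z / n)
  have hFn : ∀ n, DifferentiableOn ℂ (Fn n) unitDisk := fun n => (hG.div_const _).cexp
  have hnorm : ∀ n, ∀ z ∈ unitDisk, ‖Fn n z‖ ≤ max 1 ‖F z‖ := by
    intro n z hz'
    rw [← hGF z hz']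
    simp only [Fn, Complex.norm_exp, Complex.div_natCast_re]
    rcases le_total (G z).re 0 with h | h
    · refine le_trans ?_ (le_max_left _ _)
      rw [Real.exp_le_one_iff]
      exact div_nonpos_of_nonpos_of_nonneg h (by positivity)
    · refine le_trans ?_ (le_max_right _ _)
      rw [Real.exp_le_exp]
      rcases Nat.eq_zero_or_pos n with rfl | hn
      · simpa using h
      · exact div_le_self h (by exact_mod_cast hn)
  have hnn : ∀ n, ∀ r ∈ Ico (0 : ℝ) 1, ∀ θ,
      (‖Fn n (circlePt r θ)‖₊ : ℝ≥0∞) ≤ max 1 (maxRad F θ) := by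
    intro n r hr θ
    have h1 : ‖Fn n (circlePt r θ)‖₊ ≤ max 1 ‖F (circlePt r θ)‖₊ := hnorm n _ (circlePt_mem r θ hr)
    have h2 : (‖F (circlePt r θ)‖₊ : ℝ≥0∞) ≤ maxRad F θ :=
      le_biSup (fun r => (‖F (circlePt r θ)‖₊ : ℝ≥0∞)) hr
    calc (‖Fn n (circlePt r θ)‖₊ : ℝ≥0∞) ≤ ((max 1 ‖F (circlePt r θ)‖₊ : ℝ≥0) : ℝ≥0∞) := by
          exact_mod_cast h1
      _ = max 1 (‖F (circlePt r θ)‖₊ : ℝ≥0∞) := by simp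
      _ ≤ _ := max_le_max le_rfl h2
  have hM : ∀ n θ, maxRad (Fn n) θ ≤ max 1 (maxRad F θ) :=
    fun n θ => iSup₂_le fun r hr => hnn n r hr θ
  have hM1 : ∀ n θ, maxRad (Fn n - 1) θ ≤ 1 + max 1 (maxRad F θ) := by
    intro n θ
    refine iSup₂_le fun r hr => ?_
    have h1 : ‖(Fn n - 1) (circlePt r θ)‖₊ ≤ 1 + ‖Fn n (circlePt r θ)‖₊ := by
      have := nnnorm_sub_le (Fn n (circlePt r θ)) 1
      rw [nnnorm_one, add_comm] at this
      exact this
    calc (‖(Fn n - 1) (circlePt r θ)‖₊ : ℝ≥0∞) ≤ ((1 + ‖Fn n (circlePt r θ)‖₊ : ℝ≥0) : ℝ≥0∞) := by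
          exact_mod_cast h1
      _ = 1 + (‖Fn n (circlePt r θ)‖₊ : ℝ≥0∞) := by simp
      _ ≤ _ := by gcongr; exact hnn n r hr θ
  refine ⟨Fn, ?_, ?_⟩
  · intro n hn
    refine ⟨⟨hFn n, ?_⟩, ?_⟩
    · refine lt_of_le_of_lt ?_ hF.2
      gcongr with θ
      exact elogPlus_le _ _ (hM n θ)
    · intro z hz'
      simp only [Fn]
      rw [← Complex.exp_nat_mul, ← hGF z hz']
      congr 1
      have : (n : ℂ) ≠ 0 := by exact_mod_cast (by omega : n ≠ 0)
      field_simp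
  · have hp0 : 0 < p := by linarith
    have hlim : Tendsto (fun n => ∫⁻ θ in Ioc 0 (2 * π), elog1p (maxRad (Fn n - 1) θ) ^ p)
        atTop (𝓝 (∫⁻ θ in Ioc 0 (2 * π), 0)) := by
      apply tendsto_lintegral_of_dominated_convergence
        (fun θ => (ENNReal.ofReal (Real.log 3) + elogPlus (maxRad F θ)) ^ p)
      · intro n
        have : Measurable (maxRad (Fn n - 1)) :=
          measurable_maxRad _ ((hFn n).sub (differentiableOn_const _))
        exact (measurable_elog1p.comp this).pow_const p
      · intro n
        refine Eventually.of_forall fun θ => ?_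
        exact ENNReal.rpow_le_rpow (elog1p_le _ _ (hM1 n θ)) hp0.le
      · have hle : ∫⁻ θ in Ioc 0 (2 * π), (ENNReal.ofReal (Real.log 3) + elogPlus (maxRad F θ)) ^ p
            ≤ ∫⁻ θ in Ioc 0 (2 * π), 2 ^ (p - 1) *
              (ENNReal.ofReal (Real.log 3) ^ p + elogPlus (maxRad F θ) ^ p) := by
          gcongr with θ
          exact ENNReal.rpow_add_le_mul_rpow_add_rpow _ _ hp.le
        refine ne_top_of_le_ne_top ?_ hle
        rw [lintegral_const_mul' _ _ (ENNReal.rpow_ne_top_of_nonneg (by linarith) (by simp)),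
          lintegral_add_left measurable_const]
        apply ENNReal.mul_ne_top (ENNReal.rpow_ne_top_of_nonneg (by linarith) (by simp))
        apply ENNReal.add_ne_top.2 ⟨_, hfin⟩
        rw [lintegral_const]
        apply ENNReal.mul_ne_top (ENNReal.rpow_ne_top_of_nonneg hp0.le ENNReal.ofReal_ne_top)
        exact measure_ne_top _ _
      · filter_upwards [hbdd] with θ hθ
        obtain ⟨B, hB⟩ := hθ
        have hB0 : 0 ≤ B := (norm_nonneg _).trans (hB 0 ⟨le_rfl, zero_lt_one⟩)
        have ht1 : Tendsto (fun n : ℕ => ENNReal.ofReal (2 * (B / n))) atTop (𝓝 0) := by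
          have : Tendsto (fun n : ℕ => 2 * (B / (n : ℝ))) atTop (𝓝 0) := by
            simpa using (tendsto_const_div_atTop_nhds_zero_nat B).const_mul 2
          simpa using ENNReal.tendsto_ofReal this
        have ht2 : Tendsto (fun n => elog1p (maxRad (Fn n - 1) θ)) atTop (𝓝 0) := by
          refine tendsto_of_tendsto_of_tendsto_of_le_of_le' tendsto_const_nhds ht1
            (Eventually.of_forall fun _ => zero_le) ?_
          filter_upwards [eventually_ge_atTop (⌈B⌉₊ + 1)] with n hn
          refine (elog1p_le_self _).trans ?_
          refine iSup₂_le fun r hr => ?_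
          have hnB : B ≤ n := (Nat.le_ceil B).trans (by exact_mod_cast (by omega : ⌈B⌉₊ ≤ n))
          have hn0 : (0 : ℝ) < n := by exact_mod_cast (by omega : 0 < n)
          have h1 : ‖G (circlePt r θ) / n‖ ≤ B / n := by
            rw [norm_div, Complex.norm_natCast]
            gcongr
            exact hB r hr
          have h2 : ‖(Fn n - 1) (circlePt r θ)‖ ≤ 2 * (B / n) := by
            have := Complex.norm_exp_sub_one_le (h1.trans ((div_le_one hn0).2 hnB))
            exact this.trans (by linarith)
          rw [← enorm_eq_nnnorm, ← ofReal_norm]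
          exact ENNReal.ofReal_le_ofReal h2
        have := ((ENNReal.continuous_rpow_const (y := p)).tendsto 0).comp ht2
        rw [ENNReal.zero_rpow_of_pos hp0] at this
        exact this
    rw [lintegral_zero] at hlim
    have h2 := ENNReal.Tendsto.div_const hlim
      (Or.inr (ENNReal.ofReal_pos.2 hpi).ne' : (0 : ℝ≥0∞) ≠ 0 ∨ ENNReal.ofReal (2 * π) ≠ 0)
    rw [ENNReal.zero_div] at h2
    have h3 := ((ENNReal.continuous_rpow_const (y := 1 / p)).tendsto 0).comp h2
    rw [ENNReal.zero_rpow_of_pos (by positivity)] at h3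
    exact h3
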